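/- arXiv:0907.5338 — 2 statements merged into one kernel-verified Lean document; each statement's English description precedes it below -/
import Mathlib

section
/- Let f be a regular function in F_op with Morozova-Chentsov function c, and let ρ be a semi-quantum state on ℂ^n ⊗ ℂ^m that is positive definite, with partial traces ρ₁ = Tr₂ρ and ρ₂ = Tr₁ρ. Then for every n×n complex Hermitian matrix A and every m×m complex Hermitian matrix B, superadditivity holds: I^c_ρ(A ⊗ 1₂ + 1₁ ⊗ B) ≥ I^c_{ρ₁}(A) + I^c_{ρ₂}(B). -/
open Matrix Kronecker ComplexOrder

/-- Functional calculus: apply `g : ℝ → ℝ` to a Hermitian matrix via its spectral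
decomposition (junk value `0` on non-Hermitian matrices). -/
noncomputable def matFun {ι : Type} [Fintype ι] [DecidableEq ι] (g : ℝ → ℝ)
    (M : Matrix ι ι ℂ) : Matrix ι ι ℂ :=
  if hM : M.IsHermitian then
    ∑ i, (g (hM.eigenvalues i) : ℂ) •
      Matrix.vecMulVec (⇑(hM.eigenvectorBasis i)) (star ⇑(hM.eigenvectorBasis i))
  else 0

/-- Operator monotonicity on `(0,∞)`: monotone w.r.t. the Loewner order on positive
definite complex Hermitian matrices of all sizes. -/
def OperatorMonotone (g : ℝ → ℝ) : Prop :=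
  ∀ (k : ℕ) (A B : Matrix (Fin k) (Fin k) ℂ), A.PosDef → B.PosDef →
    (B - A).PosSemidef → (matFun g B - matFun g A).PosSemidef

/-- Operator convexity on `(0,∞)` for positive definite complex Hermitian matrices
of all sizes. -/
def OperatorConvex (g : ℝ → ℝ) : Prop :=
  ∀ (k : ℕ) (A B : Matrix (Fin k) (Fin k) ℂ), A.PosDef → B.PosDef →
    ∀ t : ℝ, 0 ≤ t → t ≤ 1 →
      (t • matFun g A + (1 - t) • matFun g B - matFun g (t • A + (1 - t) • B)).PosSemidef

/-- `ĉ(x,y) = (x-y)² · c(x,y)` where `c(x,y) = 1/(y·f(x/y))` is the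
Morozova-Chentsov function associated with `f`. -/
noncomputable def chat (f : ℝ → ℝ) (x y : ℝ) : ℝ :=
  (x - y) ^ 2 * (1 / (y * f (x / y)))

/-- The quadratic form `Σ_{k,l} ĉ(λ_k,λ_l)·|⟨u_k, A u_l⟩|²` computed from the spectral
decomposition of the Hermitian matrix `ρ` (junk value `0` on non-Hermitian matrices). -/
noncomputable def skewSum {ι : Type} [Fintype ι] [DecidableEq ι] (f : ℝ → ℝ)
    (ρ A : Matrix ι ι ℂ) : ℝ :=
  if hρ : ρ.IsHermitian then
    ∑ i, ∑ j, chat f (hρ.eigenvalues i) (hρ.eigenvalues j) *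
      Complex.normSq (star ⇑(hρ.eigenvectorBasis i) ⬝ᵥ A *ᵥ ⇑(hρ.eigenvectorBasis j))
  else 0

/-- The metric adjusted skew information
`I^c_ρ(A) = (f(0)/2)·Σ_{k,l} ĉ(λ_k,λ_l)·|⟨u_k, A u_l⟩|²`. -/
noncomputable def Ic {ι : Type} [Fintype ι] [DecidableEq ι] (f : ℝ → ℝ)
    (ρ A : Matrix ι ι ℂ) : ℝ :=
  (f 0 / 2) * skewSum f ρ A

/-- Partial trace over the second factor. -/
noncomputable def ptrace2 {n m : ℕ} (ρ : Matrix (Fin n × Fin m) (Fin n × Fin m) ℂ) :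
    Matrix (Fin n) (Fin n) ℂ :=
  Matrix.of fun i i' => ∑ j, ρ (i, j) (i', j)

/-- Partial trace over the first factor. -/
noncomputable def ptrace1 {n m : ℕ} (ρ : Matrix (Fin n × Fin m) (Fin n × Fin m) ℂ) :
    Matrix (Fin m) (Fin m) ℂ :=
  Matrix.of fun j j' => ∑ i, ρ (i, j) (i, j')

/-- A bipartite state `ρ` on `ℂⁿ ⊗ ℂᵐ` is semi-quantum if `ρ = Σ_i p_i·(P_i ⊗ ρ_i)` for
mutually orthogonal rank-one projections `(P_i)` summing to the identity, a probability
distribution `(p_i)` and density matrices `ρ_i` on the second factor. -/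
def IsSemiQuantum {n m : ℕ} (ρ : Matrix (Fin n × Fin m) (Fin n × Fin m) ℂ) : Prop :=
  ∃ (P : Fin n → Matrix (Fin n) (Fin n) ℂ) (p : Fin n → ℝ)
      (σ : Fin n → Matrix (Fin m) (Fin m) ℂ),
    (∀ i, (P i).IsHermitian) ∧ (∀ i, P i * P i = P i) ∧
    (∀ i j, i ≠ j → P i * P j = 0) ∧ (∑ i, P i = 1) ∧ (∀ i, (P i).rank = 1) ∧
    (∀ i, 0 ≤ p i) ∧ (∑ i, p i = 1) ∧
    (∀ i, (σ i).PosSemidef) ∧ (∀ i, (σ i).trace = 1) ∧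
    ρ = ∑ i, (p i : ℂ) • (P i ⊗ₖ σ i)

theorem skewSum_eq {ι : Type} [Fintype ι] [DecidableEq ι] (f : ℝ → ℝ) {ρ : Matrix ι ι ℂ}
    (hρ : ρ.IsHermitian) (A : Matrix ι ι ℂ) :
    skewSum f ρ A = ∑ i, ∑ j, chat f (hρ.eigenvalues i) (hρ.eigenvalues j) *
      Complex.normSq (((hρ.eigenvectorUnitary : Matrix ι ι ℂ)ᴴ * A *
        (hρ.eigenvectorUnitary : Matrix ι ι ℂ)) i j) := by
  rw [skewSum, dif_pos hρ]
  refine Finset.sum_congr rfl fun i _ => Finset.sum_congr rfl fun j _ => ?_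
  rw [Matrix.mul_assoc, Matrix.mul_apply_eq_vecMul]
  congr 2

theorem matFun_eq {ι : Type} [Fintype ι] [DecidableEq ι] (g : ℝ → ℝ) {M : Matrix ι ι ℂ}
    (hM : M.IsHermitian) :
    matFun g M = (hM.eigenvectorUnitary : Matrix ι ι ℂ) *
      diagonal (fun i => (g (hM.eigenvalues i) : ℂ)) *
        (hM.eigenvectorUnitary : Matrix ι ι ℂ)ᴴ := by
  rw [matFun, dif_pos hM]
  ext a b
  rw [Matrix.mul_apply]
  simp only [Matrix.sum_apply, Matrix.smul_apply, vecMulVec_apply,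
    Matrix.mul_diagonal, conjTranspose_apply, Matrix.IsHermitian.eigenvectorUnitary_apply]
  refine Finset.sum_congr rfl fun i _ => ?_
  simp only [Pi.star_apply, smul_eq_mul]
  ring

/-- Spectral decomposition in the form `M = U D Uᴴ`. -/
theorem isHermitian_eq_unitary_mul_diagonal {ι : Type} [Fintype ι] [DecidableEq ι]
    {M : Matrix ι ι ℂ} (hM : M.IsHermitian) :
    M = (hM.eigenvectorUnitary : Matrix ι ι ℂ) *
      diagonal (fun i => (hM.eigenvalues i : ℂ)) *
        (hM.eigenvectorUnitary : Matrix ι ι ℂ)ᴴ := by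
  conv_lhs => rw [hM.spectral_theorem]
  rfl

theorem eigenvectorUnitary_conjTranspose_mul {ι : Type} [Fintype ι] [DecidableEq ι]
    {M : Matrix ι ι ℂ} (hM : M.IsHermitian) :
    (hM.eigenvectorUnitary : Matrix ι ι ℂ)ᴴ * (hM.eigenvectorUnitary : Matrix ι ι ℂ) = 1 :=
  Unitary.coe_star_mul_self _

theorem eigenvectorUnitary_mul_conjTranspose {ι : Type} [Fintype ι] [DecidableEq ι]
    {M : Matrix ι ι ℂ} (hM : M.IsHermitian) :
    (hM.eigenvectorUnitary : Matrix ι ι ℂ) * (hM.eigenvectorUnitary : Matrix ι ι ℂ)ᴴ = 1 :=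
  Unitary.coe_mul_star_self _

/-- If the columns of `V` are eigenvectors of `M`, they are eigenvectors of `g(M)`. -/
theorem matFun_mul_of_mul_eq {ι κ : Type} [Fintype ι] [DecidableEq ι] [Fintype κ] [DecidableEq κ]
    (g : ℝ → ℝ) {M : Matrix ι ι ℂ} (hM : M.IsHermitian) (V : Matrix ι κ ℂ) (y : κ → ℝ)
    (h : M * V = V * diagonal (fun b => (y b : ℂ))) :
    matFun g M * V = V * diagonal (fun b => (g (y b) : ℂ)) := by
  set U : Matrix ι ι ℂ := (hM.eigenvectorUnitary : Matrix ι ι ℂ) with hU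
  have hUU : Uᴴ * U = 1 := eigenvectorUnitary_conjTranspose_mul hM
  have hUU' : U * Uᴴ = 1 := eigenvectorUnitary_mul_conjTranspose hM
  have h1 : diagonal (fun i => (hM.eigenvalues i : ℂ)) * (Uᴴ * V) =
      (Uᴴ * V) * diagonal (fun b => (y b : ℂ)) := by
    have h2 : Uᴴ * M = diagonal (fun i => (hM.eigenvalues i : ℂ)) * Uᴴ := by
      conv_lhs => rw [isHermitian_eq_unitary_mul_diagonal hM]
      rw [← hU, ← Matrix.mul_assoc, ← Matrix.mul_assoc, hUU, Matrix.one_mul]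
    rw [← Matrix.mul_assoc, ← h2, Matrix.mul_assoc, h, Matrix.mul_assoc]
  have h3 : diagonal (fun i => (g (hM.eigenvalues i) : ℂ)) * (Uᴴ * V) =
      (Uᴴ * V) * diagonal (fun b => (g (y b) : ℂ)) := by
    ext i b
    have h4 := congrFun (congrFun h1 i) b
    rw [Matrix.diagonal_mul, Matrix.mul_diagonal] at h4 ⊢
    by_cases hc : (Uᴴ * V) i b = 0
    · simp [hc]
    · rw [mul_comm] at h4
      have h5 := mul_left_cancel₀ hc h4
      rw [Complex.ofReal_inj.mp h5, mul_comm]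
  rw [matFun_eq g hM, ← hU, Matrix.mul_assoc, Matrix.mul_assoc, h3, ← Matrix.mul_assoc,
    ← Matrix.mul_assoc, hUU', Matrix.one_mul]

theorem matFun_diagonal {ι : Type} [Fintype ι] [DecidableEq ι] (g : ℝ → ℝ) (x : ι → ℝ) :
    matFun g (diagonal (fun a => (x a : ℂ))) = diagonal (fun a => (g (x a) : ℂ)) := by
  have hd : (diagonal (fun a => (x a : ℂ))).IsHermitian := by
    rw [Matrix.isHermitian_diagonal_iff]
    intro a
    simp [IsSelfAdjoint]
  simpa using matFun_mul_of_mul_eq g hd 1 x (by simp)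

theorem posDef_diagonal_ofReal {ι : Type} [Fintype ι] [DecidableEq ι] {x : ι → ℝ}
    (hx : ∀ a, 0 < x a) : (diagonal (fun a => (x a : ℂ))).PosDef := by
  rw [Matrix.posDef_diagonal_iff]
  intro a
  exact_mod_cast hx a

theorem OperatorMonotone.le_of_le {f : ℝ → ℝ} (hf : OperatorMonotone f) {x y : ℝ} (hx : 0 < x)
    (hxy : x ≤ y) : f x ≤ f y := by
  have h := hf 1 (diagonal fun _ => (x : ℂ)) (diagonal fun _ => (y : ℂ))
    (posDef_diagonal_ofReal fun _ => hx) (posDef_diagonal_ofReal fun _ => hx.trans_le hxy)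
    (by
      rw [Matrix.diagonal_sub, Matrix.posSemidef_diagonal_iff]
      intro _
      rw [sub_nonneg]
      exact_mod_cast hxy)
  rw [matFun_diagonal, matFun_diagonal, Matrix.diagonal_sub, Matrix.posSemidef_diagonal_iff] at h
  have h0 := h 0
  rw [sub_nonneg] at h0
  exact_mod_cast h0

theorem OperatorMonotone.div_le {f : ℝ → ℝ} (hf : OperatorMonotone f)
    (hf_symm : ∀ t > 0, f t = t * f (1 / t)) {x c : ℝ} (hx : 0 < x) (hc : 1 ≤ c) :
    f x / c ≤ f (x / c) := by
  have hc0 : 0 < c := by linarith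
  rw [hf_symm x hx, hf_symm (x / c) (by positivity)]
  have h1 : f (1 / x) ≤ f (1 / (x / c)) := by
    refine hf.le_of_le (by positivity) ?_
    rw [one_div_div]
    gcongr
  calc x * f (1 / x) / c = x / c * f (1 / x) := by ring
    _ ≤ _ := by gcongr

theorem star_dotProduct_diagonal_mulVec {ι : Type} [Fintype ι] [DecidableEq ι] (x : ι → ℝ)
    (u : ι → ℂ) :
    star u ⬝ᵥ (diagonal (fun a => (x a : ℂ)) *ᵥ u) =
      ((∑ a, x a * Complex.normSq (u a) : ℝ) : ℂ) := by
  simp only [dotProduct, Matrix.mulVec_diagonal, Pi.star_apply, Complex.ofReal_sum,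
    Complex.ofReal_mul, Complex.normSq_eq_conj_mul_self]
  refine Finset.sum_congr rfl fun a _ => ?_
  simp only [RCLike.star_def]
  ring

theorem normSq_add_div_le (a b : ℂ) {ε : ℝ} (hε : 0 < ε) :
    Complex.normSq (a + b) / (1 + ε) ≤ Complex.normSq a + Complex.normSq b / ε := by
  rw [div_le_iff₀ (by linarith), Complex.normSq_apply, Complex.normSq_apply, Complex.normSq_apply]
  simp only [Complex.add_re, Complex.add_im]
  have key : ∀ s t : ℝ, (s + t) * (s + t) ≤ (s * s + t * t / ε) * (1 + ε) := by
    intro s t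
    have : (s * s + t * t / ε) * (1 + ε) - (s + t) * (s + t) = (ε * s - t) ^ 2 / ε := by
      field_simp
      ring
    have h2 : 0 ≤ (ε * s - t) ^ 2 / ε := by positivity
    linarith
  have h1 := key a.re b.re
  have h2 := key a.im b.im
  calc _ ≤ (a.re * a.re + b.re * b.re / ε) * (1 + ε) + (a.im * a.im + b.im * b.im / ε) * (1 + ε) :=
        add_le_add h1 h2
    _ = _ := by ring

/-- An isometry `V` compressing `diag x` to `diag y` is dilated to a Loewner bound for `diag x`. -/
theorem posSemidef_dilation {K J : Type} [Fintype K] [DecidableEq K] [Fintype J] [DecidableEq J]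
    (V : Matrix K J ℂ) (x : K → ℝ) (y : J → ℝ) (hx : ∀ a, 0 < x a)
    (h1 : Vᴴ * V = 1)
    (hxy : Vᴴ * diagonal (fun a => (x a : ℂ)) * V = diagonal (fun b => (y b : ℂ)))
    {ε : ℝ} (hε : 0 < ε) :
    (V * diagonal (fun b => (y b : ℂ)) * Vᴴ + (((∑ a, x a) / ε : ℝ) : ℂ) • (1 - V * Vᴴ) -
      diagonal (fun a => ((x a / (1 + ε) : ℝ) : ℂ))).PosSemidef := by
  have hdy : (diagonal (fun b => (y b : ℂ)))ᴴ = diagonal (fun b => (y b : ℂ)) := by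
    rw [Matrix.diagonal_conjTranspose]
    congr 1
    ext b
    simp
  rw [Matrix.posSemidef_iff_dotProduct_mulVec]
  refine ⟨?_, fun u => ?_⟩
  · rw [Matrix.IsHermitian]
    simp only [conjTranspose_sub, conjTranspose_add, conjTranspose_mul, conjTranspose_conjTranspose,
      hdy, conjTranspose_smul, conjTranspose_one, Matrix.diagonal_conjTranspose]
    congr 2
    · rw [Matrix.mul_assoc]
    · simp
    · ext a
      simp
  · set z : J → ℂ := Vᴴ *ᵥ u with hz
    set w : K → ℂ := u - V *ᵥ z with hw
    have hu : u = V *ᵥ z + w := by rw [hw]; abel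
    have hPw : (1 - V * Vᴴ) *ᵥ u = w := by
      rw [hw, hz, Matrix.sub_mulVec, Matrix.one_mulVec, Matrix.mulVec_mulVec]
    have hVw : Vᴴ *ᵥ w = 0 := by
      rw [hw, hz, Matrix.mulVec_sub, Matrix.mulVec_mulVec, Matrix.mulVec_mulVec, h1,
        Matrix.one_mul, sub_self]
    have huw : star u ⬝ᵥ w = ((∑ a, 1 * Complex.normSq (w a) : ℝ) : ℂ) := by
      rw [← star_dotProduct_diagonal_mulVec]
      conv_lhs => rw [hu]
      rw [star_add, add_dotProduct, star_mulVec, ← dotProduct_mulVec, hVw]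
      simp
    have hVz : star u ⬝ᵥ ((V * diagonal (fun b => (y b : ℂ)) * Vᴴ) *ᵥ u) =
        ((∑ b, y b * Complex.normSq (z b) : ℝ) : ℂ) := by
      rw [← star_dotProduct_diagonal_mulVec, hz, star_mulVec, conjTranspose_conjTranspose,
        ← dotProduct_mulVec, Matrix.mulVec_mulVec, Matrix.mulVec_mulVec, Matrix.mul_assoc]
    have hyx : ∑ b, y b * Complex.normSq (z b) = ∑ a, x a * Complex.normSq ((V *ᵥ z) a) := by
      have h := star_dotProduct_diagonal_mulVec x (V *ᵥ z)
      rw [star_mulVec, ← dotProduct_mulVec, Matrix.mulVec_mulVec, Matrix.mulVec_mulVec,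
        hxy, star_dotProduct_diagonal_mulVec] at h
      exact_mod_cast h
    rw [Matrix.sub_mulVec, Matrix.add_mulVec, Matrix.smul_mulVec, hPw, dotProduct_sub,
      dotProduct_add, dotProduct_smul, hVz, huw, star_dotProduct_diagonal_mulVec, hyx,
      smul_eq_mul, ← Complex.ofReal_mul, ← Complex.ofReal_add, ← Complex.ofReal_sub,
      Complex.zero_le_real, sub_nonneg, Finset.mul_sum, ← Finset.sum_add_distrib]
    refine Finset.sum_le_sum fun a _ => ?_
    have hua : u a = (V *ᵥ z) a + w a := congrFun hu a
    have h2 := normSq_add_div_le ((V *ᵥ z) a) (w a) hε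
    have h3 : x a ≤ ∑ a, x a :=
      Finset.single_le_sum (f := x) (fun a _ => (hx a).le) (Finset.mem_univ a)
    have h4 : 0 ≤ Complex.normSq (w a) := Complex.normSq_nonneg _
    calc x a / (1 + ε) * Complex.normSq (u a)
        = x a * (Complex.normSq ((V *ᵥ z) a + w a) / (1 + ε)) := by rw [hua]; ring
      _ ≤ x a * (Complex.normSq ((V *ᵥ z) a) + Complex.normSq (w a) / ε) :=
          mul_le_mul_of_nonneg_left h2 (hx a).le
      _ = x a * Complex.normSq ((V *ᵥ z) a) + x a / ε * Complex.normSq (w a) := by ring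
      _ ≤ x a * Complex.normSq ((V *ᵥ z) a) + (∑ a, x a) / ε * (1 * Complex.normSq (w a)) := by
          rw [one_mul]
          gcongr

/-- Jensen's operator inequality for an isometry, in diagonal coordinates. -/
theorem OperatorMonotone.jensen_fin {f : ℝ → ℝ} (hf : OperatorMonotone f)
    (hf_symm : ∀ t > 0, f t = t * f (1 / t))
    {k : ℕ} {J : Type} [Fintype J] [DecidableEq J]
    (V : Matrix (Fin k) J ℂ) (x : Fin k → ℝ) (y : J → ℝ) (hx : ∀ a, 0 < x a)
    (h1 : Vᴴ * V = 1)
    (hxy : Vᴴ * diagonal (fun a => (x a : ℂ)) * V = diagonal (fun b => (y b : ℂ)))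
    (z : J → ℂ) :
    ∑ a, f (x a) * Complex.normSq ((V *ᵥ z) a) ≤ ∑ b, f (y b) * Complex.normSq (z b) := by
  have key : ∀ ε : ℝ, 0 < ε → ∑ a, f (x a) * Complex.normSq ((V *ᵥ z) a) ≤
      (1 + ε) * ∑ b, f (y b) * Complex.normSq (z b) := by
    intro ε hε
    have hpsd := posSemidef_dilation V x y hx h1 hxy hε
    set N := V * diagonal (fun b => (y b : ℂ)) * Vᴴ + (((∑ a, x a) / ε : ℝ) : ℂ) • (1 - V * Vᴴ)
      with hN
    have hD : (diagonal (fun a => ((x a / (1 + ε) : ℝ) : ℂ))).PosDef :=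
      posDef_diagonal_ofReal fun a => div_pos (hx a) (by linarith)
    have hNpos : N.PosDef := by
      have := Matrix.PosDef.posSemidef_add hpsd hD
      rwa [sub_add_cancel] at this
    have hNV : N * V = V * diagonal (fun b => (y b : ℂ)) := by
      rw [hN, Matrix.add_mul, Matrix.smul_mul, Matrix.sub_mul, Matrix.mul_assoc, Matrix.mul_assoc,
        Matrix.mul_assoc, h1]
      simp
    have hfN := matFun_mul_of_mul_eq f hNpos.isHermitian V y hNV
    have hmono := (hf k _ N hD hNpos hpsd).dotProduct_mulVec_nonneg (V *ᵥ z)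
    rw [matFun_diagonal, Matrix.sub_mulVec, dotProduct_sub, star_dotProduct_diagonal_mulVec,
      Matrix.mulVec_mulVec, hfN, star_mulVec, ← dotProduct_mulVec, Matrix.mulVec_mulVec,
      ← Matrix.mul_assoc, h1, Matrix.one_mul, star_dotProduct_diagonal_mulVec,
      ← Complex.ofReal_sub, Complex.zero_le_real, sub_nonneg] at hmono
    have h2 : (∑ a, f (x a) * Complex.normSq ((V *ᵥ z) a)) / (1 + ε) ≤
        ∑ a, f (x a / (1 + ε)) * Complex.normSq ((V *ᵥ z) a) := by
      rw [Finset.sum_div]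
      refine Finset.sum_le_sum fun a _ => ?_
      rw [mul_div_right_comm]
      exact mul_le_mul_of_nonneg_right (hf.div_le hf_symm (hx a) (by linarith))
        (Complex.normSq_nonneg _)
    have h3 := h2.trans hmono
    rwa [div_le_iff₀' (by linarith)] at h3
  have hlim : Filter.Tendsto (fun ε : ℝ => (1 + ε) * ∑ b, f (y b) * Complex.normSq (z b))
      (nhdsWithin 0 (Set.Ioi 0)) (nhds (∑ b, f (y b) * Complex.normSq (z b))) := by
    have hc : Continuous (fun ε : ℝ => (1 + ε) * ∑ b, f (y b) * Complex.normSq (z b)) := by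
      fun_prop
    have := (hc.tendsto 0).mono_left (nhdsWithin_le_nhds (s := Set.Ioi 0))
    simpa using this
  exact ge_of_tendsto hlim (Filter.eventually_of_mem self_mem_nhdsWithin key)

/-- Joint superadditivity of the perspective of an operator monotone function: the operator mean of
two positive forms that are simultaneously diagonal in the coordinates `φ` is dominated by the mean
computed in any coordinates that diagonalise both forms. -/
theorem OperatorMonotone.perspective_le {f : ℝ → ℝ} (hf : OperatorMonotone f)
    (hf_symm : ∀ t > 0, f t = t * f (1 / t))
    {K J : Type} [Fintype K] [DecidableEq K] [Fintype J] [DecidableEq J]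
    (φ : Matrix K J ℂ) {l r : K → ℝ} {l' r' : J → ℝ} (hl : ∀ a, 0 < l a) (hr : ∀ a, 0 < r a)
    (hr' : ∀ b, 0 < r' b)
    (hφl : φᴴ * diagonal (fun a => (l a : ℂ)) * φ = diagonal (fun b => (l' b : ℂ)))
    (hφr : φᴴ * diagonal (fun a => (r a : ℂ)) * φ = diagonal (fun b => (r' b : ℂ)))
    (z : J → ℂ) :
    ∑ a, r a * f (l a / r a) * Complex.normSq ((φ *ᵥ z) a) ≤
      ∑ b, r' b * f (l' b / r' b) * Complex.normSq (z b) := by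
  have hentry : ∀ (c : K → ℝ) (c' : J → ℝ),
      φᴴ * diagonal (fun a => (c a : ℂ)) * φ = diagonal (fun b => (c' b : ℂ)) →
      ∀ b b', ∑ a, star (φ a b) * (c a : ℂ) * φ a b' = diagonal (fun b => (c' b : ℂ)) b b' := by
    intro c c' h b b'
    rw [← h, Matrix.mul_apply]
    simp only [Matrix.mul_diagonal, conjTranspose_apply]
  let e : Fin (Fintype.card K) ≃ K := (Fintype.equivFin K).symm
  let V : Matrix (Fin (Fintype.card K)) J ℂ :=
    Matrix.of fun a b => ((√(r (e a)) : ℝ) : ℂ) * φ (e a) b * (((√(r' b))⁻¹ : ℝ) : ℂ)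
  have hsq : ∀ a, ((√(r a) : ℝ) : ℂ) * ((√(r a) : ℝ) : ℂ) = (r a : ℂ) := fun a => by
    rw [← Complex.ofReal_mul, Real.mul_self_sqrt (hr a).le]
  have hsq' : ∀ b, (((√(r' b))⁻¹ : ℝ) : ℂ) * (((√(r' b))⁻¹ : ℝ) : ℂ) = ((r' b)⁻¹ : ℝ) :=
    fun b => by rw [← Complex.ofReal_mul, ← mul_inv, Real.mul_self_sqrt (hr' b).le]
  have hV : ∀ (c : K → ℝ) (c' : J → ℝ),
      φᴴ * diagonal (fun a => ((c a * r a : ℝ) : ℂ)) * φ = diagonal (fun b => (c' b : ℂ)) →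
      Vᴴ * diagonal (fun a => (c (e a) : ℂ)) * V =
        diagonal (fun b => ((c' b / r' b : ℝ) : ℂ)) := by
    intro c c' h
    ext b b'
    have h' := hentry (fun a => c a * r a) c' h b b'
    rw [← e.sum_comp] at h'
    rw [Matrix.mul_apply]
    simp only [Matrix.mul_diagonal, conjTranspose_apply, V, Matrix.of_apply]
    calc _ = ∑ a, (star (φ (e a) b) * ((c (e a) * r (e a) : ℝ) : ℂ) * φ (e a) b') *
          ((((√(r' b))⁻¹ : ℝ) : ℂ) * (((√(r' b'))⁻¹ : ℝ) : ℂ)) := by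
          refine Finset.sum_congr rfl fun a _ => ?_
          rw [Complex.ofReal_mul, ← hsq (e a)]
          simp only [star_mul', RCLike.star_def, Complex.conj_ofReal]
          ring
      _ = _ := by
          rw [← Finset.sum_mul, h']
          by_cases hb : b = b'
          · subst hb
            rw [Matrix.diagonal_apply_eq, Matrix.diagonal_apply_eq, hsq', ← Complex.ofReal_mul,
              div_eq_mul_inv]
          · rw [Matrix.diagonal_apply_ne _ hb, Matrix.diagonal_apply_ne _ hb, zero_mul]
  have hV1 : Vᴴ * V = 1 := by
    have h := hV (fun _ => 1) r' (by simpa using hφr)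
    simp only [Complex.ofReal_one, Matrix.diagonal_one, Matrix.mul_one] at h
    rw [h, ← Matrix.diagonal_one]
    congr 1
    ext b
    rw [div_self (hr' b).ne', Complex.ofReal_one]
  have hVx := hV (fun a => l a / r a) l' (by
    rw [← hφl]
    congr 3
    ext a
    rw [div_mul_cancel₀ _ (hr a).ne'])
  have hJ := hf.jensen_fin hf_symm V (fun a => l (e a) / r (e a)) (fun b => l' b / r' b)
    (fun a => div_pos (hl _) (hr _)) hV1 hVx (fun b => ((√(r' b) : ℝ) : ℂ) * z b)
  have hmul : ∀ a, (V *ᵥ fun b => ((√(r' b) : ℝ) : ℂ) * z b) a =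
      ((√(r (e a)) : ℝ) : ℂ) * (φ *ᵥ z) (e a) := by
    intro a
    simp only [Matrix.mulVec, dotProduct, V, Matrix.of_apply, Finset.mul_sum]
    refine Finset.sum_congr rfl fun b _ => ?_
    have hb : (((√(r' b))⁻¹ : ℝ) : ℂ) * ((√(r' b) : ℝ) : ℂ) = 1 := by
      rw [← Complex.ofReal_mul, inv_mul_cancel₀ (Real.sqrt_pos.mpr (hr' b)).ne', Complex.ofReal_one]
    linear_combination ((√(r (e a)) : ℝ) : ℂ) * φ (e a) b * z b * hb
  simp only [hmul, Complex.normSq_mul, Complex.normSq_ofReal, Real.mul_self_sqrt (hr _).le,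
    Real.mul_self_sqrt (hr' _).le] at hJ
  calc _ = ∑ a, f (l (e a) / r (e a)) * (r (e a) * Complex.normSq ((φ *ᵥ z) (e a))) := by
        rw [← e.sum_comp]
        exact Finset.sum_congr rfl fun a _ => by ring
    _ ≤ _ := hJ
    _ = _ := Finset.sum_congr rfl fun b _ => by ring

/-- The coordinates `Uᴴ Y U` of `Y` in the eigenbasis of the Hermitian matrix `ρ`. -/
noncomputable def eigenCoord {ι : Type} [Fintype ι] [DecidableEq ι] {ρ : Matrix ι ι ℂ}
    (hρ : ρ.IsHermitian) (Y : Matrix ι ι ℂ) : Matrix ι ι ℂ :=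
  (hρ.eigenvectorUnitary : Matrix ι ι ℂ)ᴴ * Y * (hρ.eigenvectorUnitary : Matrix ι ι ℂ)

/-- The matrix whose coordinates in the eigenbasis of `ρ` are `Z`. -/
noncomputable def ofEigenCoord {ι : Type} [Fintype ι] [DecidableEq ι] {ρ : Matrix ι ι ℂ}
    (hρ : ρ.IsHermitian) (Z : Matrix ι ι ℂ) : Matrix ι ι ℂ :=
  (hρ.eigenvectorUnitary : Matrix ι ι ℂ) * Z * (hρ.eigenvectorUnitary : Matrix ι ι ℂ)ᴴ

/-- The quadratic form `⟨Y, m_f(L_ρ, R_ρ) Y⟩` with `m_f(x,y) = y f(x/y)`. -/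
noncomputable def meanForm {ι : Type} [Fintype ι] [DecidableEq ι] (f : ℝ → ℝ) {ρ : Matrix ι ι ℂ}
    (hρ : ρ.IsHermitian) (Y : Matrix ι ι ℂ) : ℝ :=
  ∑ a : ι × ι, hρ.eigenvalues a.2 * f (hρ.eigenvalues a.1 / hρ.eigenvalues a.2) *
    Complex.normSq (eigenCoord hρ Y a.1 a.2)

section EigenCoord

variable {ι : Type} [Fintype ι] [DecidableEq ι] {ρ : Matrix ι ι ℂ} (hρ : ρ.IsHermitian)

theorem eigenCoord_ofEigenCoord (Z : Matrix ι ι ℂ) : eigenCoord hρ (ofEigenCoord hρ Z) = Z := by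
  have h := eigenvectorUnitary_conjTranspose_mul hρ
  simp only [eigenCoord, ofEigenCoord]
  rw [Matrix.mul_assoc, Matrix.mul_assoc _ _ (hρ.eigenvectorUnitary : Matrix ι ι ℂ), h,
    Matrix.mul_one, ← Matrix.mul_assoc, h, Matrix.one_mul]

theorem ofEigenCoord_eigenCoord (Y : Matrix ι ι ℂ) : ofEigenCoord hρ (eigenCoord hρ Y) = Y := by
  have h := eigenvectorUnitary_mul_conjTranspose hρ
  simp only [eigenCoord, ofEigenCoord]
  rw [Matrix.mul_assoc, Matrix.mul_assoc _ _ (hρ.eigenvectorUnitary : Matrix ι ι ℂ)ᴴ, h,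
    Matrix.mul_one, ← Matrix.mul_assoc, h, Matrix.one_mul]

theorem eigenCoord_mul (Y Y' : Matrix ι ι ℂ) :
    eigenCoord hρ (Y * Y') = eigenCoord hρ Y * eigenCoord hρ Y' := by
  have h := eigenvectorUnitary_mul_conjTranspose hρ
  simp only [eigenCoord, Matrix.mul_assoc]
  rw [← Matrix.mul_assoc _ (_ᴴ) (Y' * _), h, Matrix.one_mul]

theorem eigenCoord_conjTranspose (Y : Matrix ι ι ℂ) : eigenCoord hρ Yᴴ = (eigenCoord hρ Y)ᴴ := by
  simp only [eigenCoord, conjTranspose_mul, conjTranspose_conjTranspose, Matrix.mul_assoc]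

theorem eigenCoord_add (Y Y' : Matrix ι ι ℂ) :
    eigenCoord hρ (Y + Y') = eigenCoord hρ Y + eigenCoord hρ Y' := by
  simp only [eigenCoord, Matrix.mul_add, Matrix.add_mul]

theorem eigenCoord_sub (Y Y' : Matrix ι ι ℂ) :
    eigenCoord hρ (Y - Y') = eigenCoord hρ Y - eigenCoord hρ Y' := by
  simp only [eigenCoord, Matrix.mul_sub, Matrix.sub_mul]

theorem eigenCoord_smul (c : ℂ) (Y : Matrix ι ι ℂ) :
    eigenCoord hρ (c • Y) = c • eigenCoord hρ Y := by
  simp only [eigenCoord, Matrix.mul_smul, Matrix.smul_mul]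

theorem ofEigenCoord_add (Y Y' : Matrix ι ι ℂ) :
    ofEigenCoord hρ (Y + Y') = ofEigenCoord hρ Y + ofEigenCoord hρ Y' := by
  simp only [ofEigenCoord, Matrix.mul_add, Matrix.add_mul]

theorem ofEigenCoord_smul (c : ℂ) (Y : Matrix ι ι ℂ) :
    ofEigenCoord hρ (c • Y) = c • ofEigenCoord hρ Y := by
  simp only [ofEigenCoord, Matrix.mul_smul, Matrix.smul_mul]

theorem eigenCoord_injective : Function.Injective (eigenCoord hρ) :=
  Function.LeftInverse.injective (ofEigenCoord_eigenCoord hρ)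

theorem eigenCoord_self : eigenCoord hρ ρ = diagonal (fun i => (hρ.eigenvalues i : ℂ)) := by
  conv_lhs => enter [2]; rw [isHermitian_eq_unitary_mul_diagonal hρ]
  exact eigenCoord_ofEigenCoord hρ _

theorem trace_eigenCoord (Y : Matrix ι ι ℂ) : (eigenCoord hρ Y).trace = Y.trace := by
  rw [eigenCoord, Matrix.trace_mul_comm, ← Matrix.mul_assoc,
    eigenvectorUnitary_mul_conjTranspose hρ, Matrix.one_mul]

theorem trace_mul_eq_sum (C : Matrix ι ι ℂ) :
    (ρ * C).trace = ∑ i, (hρ.eigenvalues i : ℂ) * eigenCoord hρ C i i := by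
  rw [← trace_eigenCoord hρ, eigenCoord_mul, eigenCoord_self]
  simp [Matrix.trace, Matrix.diagonal_mul]

theorem trace_mul_mul_conjTranspose (Y Y' : Matrix ι ι ℂ) :
    (ρ * (Y' * Yᴴ)).trace = ∑ a : ι × ι, star (eigenCoord hρ Y a.1 a.2) *
      (hρ.eigenvalues a.1 : ℂ) * eigenCoord hρ Y' a.1 a.2 := by
  rw [trace_mul_eq_sum hρ, eigenCoord_mul, eigenCoord_conjTranspose, Fintype.sum_prod_type]
  refine Finset.sum_congr rfl fun i _ => ?_
  rw [Matrix.mul_apply, Finset.mul_sum]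
  refine Finset.sum_congr rfl fun j _ => ?_
  rw [conjTranspose_apply]
  ring

theorem trace_mul_conjTranspose_mul (Y Y' : Matrix ι ι ℂ) :
    (ρ * (Yᴴ * Y')).trace = ∑ a : ι × ι, star (eigenCoord hρ Y a.1 a.2) *
      (hρ.eigenvalues a.2 : ℂ) * eigenCoord hρ Y' a.1 a.2 := by
  rw [trace_mul_eq_sum hρ, eigenCoord_mul, eigenCoord_conjTranspose, Fintype.sum_prod_type,
    Finset.sum_comm]
  refine Finset.sum_congr rfl fun i _ => ?_
  rw [Matrix.mul_apply, Finset.mul_sum]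
  refine Finset.sum_congr rfl fun j _ => ?_
  rw [conjTranspose_apply]
  ring

/-- A matrix vanishing between equal eigenvalues of `ρ` is a commutator with `ρ`. -/
theorem exists_eq_commutator {Y : Matrix ι ι ℂ}
    (hY : ∀ i j, hρ.eigenvalues i = hρ.eigenvalues j → eigenCoord hρ Y i j = 0) :
    ∃ G, Y = ρ * G - G * ρ := by
  refine ⟨ofEigenCoord hρ (Matrix.of fun i j =>
    eigenCoord hρ Y i j / ((hρ.eigenvalues i : ℂ) - hρ.eigenvalues j)), ?_⟩
  apply eigenCoord_injective hρ
  rw [eigenCoord_sub, eigenCoord_mul, eigenCoord_mul, eigenCoord_ofEigenCoord, eigenCoord_self]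
  ext i j
  rw [Matrix.sub_apply, Matrix.diagonal_mul, Matrix.mul_diagonal, Matrix.of_apply]
  by_cases h : hρ.eigenvalues i = hρ.eigenvalues j
  · rw [hY i j h]
    simp
  · have h' : (hρ.eigenvalues i : ℂ) - hρ.eigenvalues j ≠ 0 := by
      rw [sub_ne_zero]
      exact_mod_cast h
    field_simp

theorem skewSum_eq_sum (f : ℝ → ℝ) (X : Matrix ι ι ℂ) :
    skewSum f ρ X = ∑ a : ι × ι, chat f (hρ.eigenvalues a.1) (hρ.eigenvalues a.2) *
      Complex.normSq (eigenCoord hρ X a.1 a.2) := by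
  rw [skewSum_eq f hρ, Fintype.sum_prod_type]
  rfl

theorem trace_commutator (X Y : Matrix ι ι ℂ) :
    (ρ * (X * Yᴴ - Yᴴ * X)).trace.re = ∑ a : ι × ι,
      (hρ.eigenvalues a.1 - hρ.eigenvalues a.2) *
        (star (eigenCoord hρ Y a.1 a.2) * eigenCoord hρ X a.1 a.2).re := by
  rw [Matrix.mul_sub, Matrix.trace_sub, trace_mul_mul_conjTranspose hρ,
    trace_mul_conjTranspose_mul hρ, ← Finset.sum_sub_distrib, Complex.re_sum]
  refine Finset.sum_congr rfl fun a _ => ?_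
  rw [← Complex.re_ofReal_mul]
  congr 1
  push_cast
  ring

/-- Variational lower bound for the skew information. -/
theorem two_mul_trace_sub_meanForm_le {f : ℝ → ℝ} (hf_pos : ∀ t > 0, 0 < f t)
    (hpos : ∀ i, 0 < hρ.eigenvalues i) (X Y : Matrix ι ι ℂ) :
    2 * (ρ * (X * Yᴴ - Yᴴ * X)).trace.re - meanForm f hρ Y ≤ skewSum f ρ X := by
  rw [trace_commutator hρ, skewSum_eq_sum hρ, meanForm, Finset.mul_sum, ← Finset.sum_sub_distrib]
  refine Finset.sum_le_sum fun a _ => ?_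
  have hm : 0 < hρ.eigenvalues a.2 * f (hρ.eigenvalues a.1 / hρ.eigenvalues a.2) :=
    mul_pos (hpos _) (hf_pos _ (div_pos (hpos _) (hpos _)))
  rw [chat]
  generalize hρ.eigenvalues a.2 * f (hρ.eigenvalues a.1 / hρ.eigenvalues a.2) = m at hm ⊢
  generalize hρ.eigenvalues a.1 - hρ.eigenvalues a.2 = d
  generalize eigenCoord hρ Y a.1 a.2 = y
  generalize eigenCoord hρ X a.1 a.2 = x
  have h : d ^ 2 * (1 / m) * Complex.normSq x - (2 * (d * (star y * x).re) -
      m * Complex.normSq y) = ((d * x.re - m * y.re) ^ 2 + (d * x.im - m * y.im) ^ 2) / m := by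
    rw [Complex.normSq_apply, Complex.normSq_apply, RCLike.star_def, Complex.mul_re,
      Complex.conj_re, Complex.conj_im]
    field_simp
    ring
  have h2 : 0 ≤ ((d * x.re - m * y.re) ^ 2 + (d * x.im - m * y.im) ^ 2) / m := by positivity
  linarith

/-- The variational bound for the skew information is attained. -/
theorem exists_trace_eq_skewSum {f : ℝ → ℝ} (hf_pos : ∀ t > 0, 0 < f t)
    (hpos : ∀ i, 0 < hρ.eigenvalues i) (X : Matrix ι ι ℂ) :
    ∃ Y, (∀ i j, hρ.eigenvalues i = hρ.eigenvalues j → eigenCoord hρ Y i j = 0) ∧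
      (ρ * (X * Yᴴ - Yᴴ * X)).trace.re = skewSum f ρ X ∧ meanForm f hρ Y = skewSum f ρ X := by
  refine ⟨ofEigenCoord hρ (Matrix.of fun i j =>
    (((hρ.eigenvalues i - hρ.eigenvalues j) /
      (hρ.eigenvalues j * f (hρ.eigenvalues i / hρ.eigenvalues j)) : ℝ) : ℂ) *
        eigenCoord hρ X i j), ?_, ?_, ?_⟩
  · intro i j h
    rw [eigenCoord_ofEigenCoord, Matrix.of_apply, h]
    simp
  · rw [trace_commutator hρ, skewSum_eq_sum hρ, eigenCoord_ofEigenCoord]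
    refine Finset.sum_congr rfl fun a _ => ?_
    rw [Matrix.of_apply, chat, star_mul', RCLike.star_def, Complex.conj_ofReal,
      mul_assoc (_ : ℂ), ← Complex.normSq_eq_conj_mul_self, Complex.re_ofReal_mul, Complex.ofReal_re]
    ring
  · rw [meanForm, skewSum_eq_sum hρ, eigenCoord_ofEigenCoord]
    refine Finset.sum_congr rfl fun a _ => ?_
    have hm : 0 < hρ.eigenvalues a.2 * f (hρ.eigenvalues a.1 / hρ.eigenvalues a.2) :=
      mul_pos (hpos _) (hf_pos _ (div_pos (hpos _) (hpos _)))
    rw [Matrix.of_apply, chat, Complex.normSq_mul, Complex.normSq_ofReal]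
    field_simp

end EigenCoord

section Bipartite

variable {n m : ℕ} {ρ : Matrix (Fin n × Fin m) (Fin n × Fin m) ℂ}

theorem trace_mul_kronecker_one (ρ : Matrix (Fin n × Fin m) (Fin n × Fin m) ℂ)
    (C : Matrix (Fin n) (Fin n) ℂ) :
    (ρ * (C ⊗ₖ (1 : Matrix (Fin m) (Fin m) ℂ))).trace = (ptrace2 ρ * C).trace := by
  simp only [Matrix.trace, Matrix.diag_apply, Matrix.mul_apply, Fintype.sum_prod_type, ptrace2,
    kroneckerMap_apply, Matrix.of_apply, Matrix.one_apply, mul_ite, mul_one, mul_zero,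
    Finset.sum_ite_eq', Finset.mem_univ, if_true, Finset.sum_mul]
  exact Finset.sum_congr rfl fun i _ => Finset.sum_comm

theorem trace_mul_one_kronecker (ρ : Matrix (Fin n × Fin m) (Fin n × Fin m) ℂ)
    (D : Matrix (Fin m) (Fin m) ℂ) :
    (ρ * ((1 : Matrix (Fin n) (Fin n) ℂ) ⊗ₖ D)).trace = (ptrace1 ρ * D).trace := by
  simp only [Matrix.trace, Matrix.diag_apply, Matrix.mul_apply, Fintype.sum_prod_type, ptrace1,
    kroneckerMap_apply, Matrix.of_apply, Matrix.one_apply, mul_ite, ite_mul, one_mul, zero_mul,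
    mul_zero, Finset.sum_mul]
  rw [Finset.sum_comm]
  refine Finset.sum_congr rfl fun j _ => ?_
  rw [Finset.sum_comm]
  conv_rhs => rw [Finset.sum_comm]
  rw [Finset.sum_comm]
  refine Finset.sum_congr rfl fun i _ => ?_
  rw [Finset.sum_comm]
  refine Finset.sum_congr rfl fun j' _ => ?_
  simp

theorem ptrace2_posDef (hρ : ρ.PosDef) [Nonempty (Fin m)] : (ptrace2 ρ).PosDef := by
  have h : ptrace2 ρ = ∑ j, ρ.submatrix (fun i => (i, j)) (fun i => (i, j)) := by
    ext i i'
    simp [ptrace2, Matrix.sum_apply]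
  rw [h]
  exact Matrix.posDef_sum Finset.univ_nonempty fun j _ => hρ.submatrix fun i i' hi => (Prod.ext_iff.mp hi).1

theorem ptrace1_posDef (hρ : ρ.PosDef) [Nonempty (Fin n)] : (ptrace1 ρ).PosDef := by
  have h : ptrace1 ρ = ∑ i, ρ.submatrix (fun j => (i, j)) (fun j => (i, j)) := by
    ext j j'
    simp [ptrace1, Matrix.sum_apply]
  rw [h]
  exact Matrix.posDef_sum Finset.univ_nonempty fun i _ => hρ.submatrix fun j j' hj => (Prod.ext_iff.mp hj).2

/-- A semi-quantum state commutes with its quantum-classical marginal. -/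
theorem IsSemiQuantum.commute (h : IsSemiQuantum ρ) :
    ρ * (ptrace2 ρ ⊗ₖ (1 : Matrix (Fin m) (Fin m) ℂ)) =
      (ptrace2 ρ ⊗ₖ (1 : Matrix (Fin m) (Fin m) ℂ)) * ρ := by
  obtain ⟨P, p, σ, -, -, hPP, -, -, -, -, -, hσ, hρ⟩ := h
  have h1 : ptrace2 ρ = ∑ i, (p i : ℂ) • P i := by
    ext a b
    have hs : ∀ i, ∑ j, σ i j j = 1 := hσ
    simp only [ptrace2, hρ, Matrix.of_apply, Matrix.sum_apply, Matrix.smul_apply,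
      kroneckerMap_apply, smul_eq_mul]
    rw [Finset.sum_comm]
    refine Finset.sum_congr rfl fun i _ => ?_
    simp only [← mul_assoc]
    rw [← Finset.mul_sum, hs, mul_one]
  have hcomm : ∀ i, P i * ptrace2 ρ = ptrace2 ρ * P i := by
    intro i
    rw [h1, Finset.mul_sum, Finset.sum_mul]
    refine Finset.sum_congr rfl fun j _ => ?_
    rw [Matrix.mul_smul, Matrix.smul_mul]
    by_cases hij : i = j
    · rw [hij]
    · rw [hPP i j hij, hPP j i (Ne.symm hij)]
  conv_lhs => enter [1]; rw [hρ]
  conv_rhs => enter [2]; rw [hρ]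
  rw [Finset.sum_mul, Finset.mul_sum]
  refine Finset.sum_congr rfl fun i _ => ?_
  rw [Matrix.smul_mul, Matrix.mul_smul, ← Matrix.mul_kronecker_mul, ← Matrix.mul_kronecker_mul,
    hcomm, Matrix.one_mul, Matrix.mul_one]

theorem trace_mul_kronecker_eq_zero (hρ1 : (ptrace2 ρ).IsHermitian)
    (hcomm : ρ * (ptrace2 ρ ⊗ₖ (1 : Matrix (Fin m) (Fin m) ℂ)) =
      (ptrace2 ρ ⊗ₖ (1 : Matrix (Fin m) (Fin m) ℂ)) * ρ)
    {Y : Matrix (Fin n) (Fin n) ℂ}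
    (hY : ∀ i j, hρ1.eigenvalues i = hρ1.eigenvalues j → eigenCoord hρ1 Y i j = 0)
    (D : Matrix (Fin m) (Fin m) ℂ) : (ρ * (Y ⊗ₖ D)).trace = 0 := by
  obtain ⟨G, rfl⟩ := exists_eq_commutator hρ1 hY
  have h : (ptrace2 ρ * G - G * ptrace2 ρ) ⊗ₖ D =
      (ptrace2 ρ ⊗ₖ (1 : Matrix (Fin m) (Fin m) ℂ)) * (G ⊗ₖ D) -
        (G ⊗ₖ D) * (ptrace2 ρ ⊗ₖ (1 : Matrix (Fin m) (Fin m) ℂ)) := by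
    rw [← Matrix.mul_kronecker_mul, ← Matrix.mul_kronecker_mul, Matrix.one_mul, Matrix.mul_one]
    ext a b
    simp [sub_mul]
  rw [h, Matrix.mul_sub, Matrix.trace_sub, ← Matrix.mul_assoc, hcomm, Matrix.mul_assoc,
    Matrix.trace_mul_comm, Matrix.mul_assoc, sub_self]

/-- `A ⊗ 1 + 1 ⊗ B`. -/
noncomputable def kronSum (A : Matrix (Fin n) (Fin n) ℂ) (B : Matrix (Fin m) (Fin m) ℂ) :
    Matrix (Fin n × Fin m) (Fin n × Fin m) ℂ :=
  A ⊗ₖ (1 : Matrix (Fin m) (Fin m) ℂ) + (1 : Matrix (Fin n) (Fin n) ℂ) ⊗ₖ B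

theorem kronSum_add (A A' : Matrix (Fin n) (Fin n) ℂ) (B B' : Matrix (Fin m) (Fin m) ℂ) :
    kronSum (A + A') (B + B') = kronSum A B + kronSum A' B' := by
  simp only [kronSum, Matrix.add_kronecker, Matrix.kronecker_add]
  abel

theorem kronSum_smul (c : ℂ) (A : Matrix (Fin n) (Fin n) ℂ) (B : Matrix (Fin m) (Fin m) ℂ) :
    kronSum (c • A) (c • B) = c • kronSum A B := by
  simp only [kronSum, Matrix.smul_kronecker, Matrix.kronecker_smul, smul_add]

theorem kronSum_conjTranspose (A : Matrix (Fin n) (Fin n) ℂ) (B : Matrix (Fin m) (Fin m) ℂ) :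
    (kronSum A B)ᴴ = kronSum Aᴴ Bᴴ := by
  simp only [kronSum, conjTranspose_add, Matrix.conjTranspose_kronecker, conjTranspose_one]

theorem kronSum_mul (A A' : Matrix (Fin n) (Fin n) ℂ) (B B' : Matrix (Fin m) (Fin m) ℂ) :
    kronSum A B * kronSum A' B' = kronSum (A * A') (B * B') + A ⊗ₖ B' + A' ⊗ₖ B := by
  simp only [kronSum, Matrix.mul_add, Matrix.add_mul, ← Matrix.mul_kronecker_mul, Matrix.one_mul,
    Matrix.mul_one]
  abel

theorem trace_mul_kronSum (A : Matrix (Fin n) (Fin n) ℂ) (B : Matrix (Fin m) (Fin m) ℂ) :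
    (ρ * kronSum A B).trace = (ptrace2 ρ * A).trace + (ptrace1 ρ * B).trace := by
  rw [kronSum, Matrix.mul_add, Matrix.trace_add, trace_mul_kronecker_one, trace_mul_one_kronecker]

theorem trace_commutator_kronSum (A Y : Matrix (Fin n) (Fin n) ℂ) (B W : Matrix (Fin m) (Fin m) ℂ) :
    (ρ * (kronSum A B * (kronSum Y W)ᴴ - (kronSum Y W)ᴴ * kronSum A B)).trace =
      (ptrace2 ρ * (A * Yᴴ - Yᴴ * A)).trace + (ptrace1 ρ * (B * Wᴴ - Wᴴ * B)).trace := by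
  rw [kronSum_conjTranspose, kronSum_mul, kronSum_mul]
  have h : kronSum (A * Yᴴ) (B * Wᴴ) + A ⊗ₖ Wᴴ + Yᴴ ⊗ₖ B -
      (kronSum (Yᴴ * A) (Wᴴ * B) + Yᴴ ⊗ₖ B + A ⊗ₖ Wᴴ) =
      kronSum (A * Yᴴ) (B * Wᴴ) - kronSum (Yᴴ * A) (Wᴴ * B) := by abel
  rw [h, Matrix.mul_sub, Matrix.trace_sub, trace_mul_kronSum, trace_mul_kronSum, Matrix.mul_sub,
    Matrix.mul_sub, Matrix.trace_sub, Matrix.trace_sub]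
  ring

/-- Pairs of eigenvectors of `ρ₁` with distinct eigenvalues, and pairs of eigenvectors of `ρ₂`. -/
abbrev MarginalIndex (hρ1 : (ptrace2 ρ).IsHermitian) : Type :=
  {a : Fin n × Fin n // hρ1.eigenvalues a.1 ≠ hρ1.eigenvalues a.2} ⊕ (Fin m × Fin m)

open Classical in
/-- The first-factor matrix with given eigencoordinates between distinct eigenvalues of `ρ₁`. -/
noncomputable def firstPart (hρ1 : (ptrace2 ρ).IsHermitian) (z : MarginalIndex hρ1 → ℂ) :
    Matrix (Fin n) (Fin n) ℂ :=
  ofEigenCoord hρ1 (Matrix.of fun k l =>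
    if h : hρ1.eigenvalues k ≠ hρ1.eigenvalues l then z (Sum.inl ⟨(k, l), h⟩) else 0)

/-- The second-factor matrix with given eigencoordinates. -/
noncomputable def secondPart (hρ1 : (ptrace2 ρ).IsHermitian) (hρ2 : (ptrace1 ρ).IsHermitian)
    (z : MarginalIndex hρ1 → ℂ) : Matrix (Fin m) (Fin m) ℂ :=
  ofEigenCoord hρ2 (Matrix.of fun k l => z (Sum.inr (k, l)))

theorem eigenCoord_firstPart_eq_zero (hρ1 : (ptrace2 ρ).IsHermitian) (z : MarginalIndex hρ1 → ℂ)
    (k l : Fin n) (h : hρ1.eigenvalues k = hρ1.eigenvalues l) :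
    eigenCoord hρ1 (firstPart hρ1 z) k l = 0 := by
  simp [firstPart, eigenCoord_ofEigenCoord, h]

theorem eigenCoord_firstPart (hρ1 : (ptrace2 ρ).IsHermitian) (z : MarginalIndex hρ1 → ℂ)
    (a : {a : Fin n × Fin n // hρ1.eigenvalues a.1 ≠ hρ1.eigenvalues a.2}) :
    eigenCoord hρ1 (firstPart hρ1 z) a.1.1 a.1.2 = z (Sum.inl a) := by
  rw [firstPart, eigenCoord_ofEigenCoord, Matrix.of_apply, dif_pos a.2]

theorem eigenCoord_secondPart (hρ1 : (ptrace2 ρ).IsHermitian) (hρ2 : (ptrace1 ρ).IsHermitian)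
    (z : MarginalIndex hρ1 → ℂ) (a : Fin m × Fin m) :
    eigenCoord hρ2 (secondPart hρ1 hρ2 z) a.1 a.2 = z (Sum.inr a) := by
  rw [secondPart, eigenCoord_ofEigenCoord, Matrix.of_apply]

theorem sum_subtype_eigenvalues_ne {M : Type} [AddCommMonoid M] (hρ1 : (ptrace2 ρ).IsHermitian)
    (g : Fin n × Fin n → M)
    (hg : ∀ a : Fin n × Fin n, hρ1.eigenvalues a.1 = hρ1.eigenvalues a.2 → g a = 0) :
    ∑ a : Fin n × Fin n, g a =
      ∑ a : {a : Fin n × Fin n // hρ1.eigenvalues a.1 ≠ hρ1.eigenvalues a.2}, g a.1 := by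
  classical
  rw [← Finset.sum_filter_of_ne (s := Finset.univ)
    (p := fun a => hρ1.eigenvalues a.1 ≠ hρ1.eigenvalues a.2) fun a _ ha h => ha (hg a h)]
  exact Finset.sum_subtype _ (by simp) g

/-- The coordinates, in the eigenbasis of `ρ`, of the kronecker sum of the two parts. -/
noncomputable def marginalMap (hρ : ρ.IsHermitian) (hρ1 : (ptrace2 ρ).IsHermitian)
    (hρ2 : (ptrace1 ρ).IsHermitian) :
    (MarginalIndex hρ1 → ℂ) →ₗ[ℂ] ((Fin n × Fin m) × (Fin n × Fin m) → ℂ) where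
  toFun z a := eigenCoord hρ (kronSum (firstPart hρ1 z) (secondPart hρ1 hρ2 z)) a.1 a.2
  map_add' z w := by
    have h1 : firstPart hρ1 (z + w) = firstPart hρ1 z + firstPart hρ1 w := by
      rw [firstPart, firstPart, firstPart, ← ofEigenCoord_add]
      congr 1
      ext k l
      by_cases h : hρ1.eigenvalues k = hρ1.eigenvalues l <;> simp [h]
    have h2 : secondPart hρ1 hρ2 (z + w) = secondPart hρ1 hρ2 z + secondPart hρ1 hρ2 w := by
      rw [secondPart, secondPart, secondPart, ← ofEigenCoord_add]
      rfl
    ext a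
    rw [h1, h2, kronSum_add, eigenCoord_add]
    rfl
  map_smul' c z := by
    have h1 : firstPart hρ1 (c • z) = c • firstPart hρ1 z := by
      rw [firstPart, firstPart, ← ofEigenCoord_smul]
      congr 1
      ext k l
      by_cases h : hρ1.eigenvalues k = hρ1.eigenvalues l <;> simp [h]
    have h2 : secondPart hρ1 hρ2 (c • z) = c • secondPart hρ1 hρ2 z := by
      rw [secondPart, secondPart, ← ofEigenCoord_smul]
      rfl
    ext a
    rw [h1, h2, kronSum_smul, eigenCoord_smul]
    rfl

theorem toMatrix_conj_diagonal {K J : Type} [Fintype K] [DecidableEq K] [Fintype J] [DecidableEq J]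
    (Φ : (J → ℂ) →ₗ[ℂ] (K → ℂ)) (c : K → ℝ) (c' : J → ℝ)
    (h : ∀ z w, ∑ a, star (Φ z a) * (c a : ℂ) * Φ w a = ∑ b, star (z b) * (c' b : ℂ) * w b) :
    (LinearMap.toMatrix' Φ)ᴴ * diagonal (fun a => (c a : ℂ)) * LinearMap.toMatrix' Φ =
      diagonal (fun b => (c' b : ℂ)) := by
  ext b b'
  rw [Matrix.mul_apply]
  simp only [Matrix.mul_diagonal, conjTranspose_apply, LinearMap.toMatrix'_apply]
  have h' := h (Pi.single b 1) (Pi.single b' 1)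
  refine Eq.trans ?_ (h'.trans ?_)
  · refine Finset.sum_congr rfl fun a _ => ?_
    congr!
  · by_cases hb : b = b'
    · subst hb
      simp [Pi.single_apply]
    · rw [Matrix.diagonal_apply_ne _ hb]
      refine Finset.sum_eq_zero fun x _ => ?_
      by_cases hx : x = b'
      · have : x ≠ b := fun h => hb (h ▸ hx)
        simp [Pi.single_apply, this]
      · simp [Pi.single_apply, hx]

theorem meanForm_kronSum_le {f : ℝ → ℝ} (hf : OperatorMonotone f)
    (hf_symm : ∀ t > 0, f t = t * f (1 / t)) (hρ : ρ.PosDef) (hρ1 : (ptrace2 ρ).PosDef)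
    (hρ2 : (ptrace1 ρ).PosDef)
    (hcomm : ρ * (ptrace2 ρ ⊗ₖ (1 : Matrix (Fin m) (Fin m) ℂ)) =
      (ptrace2 ρ ⊗ₖ (1 : Matrix (Fin m) (Fin m) ℂ)) * ρ)
    (Y : Matrix (Fin n) (Fin n) ℂ)
    (hY : ∀ i j, hρ1.isHermitian.eigenvalues i = hρ1.isHermitian.eigenvalues j →
      eigenCoord hρ1.isHermitian Y i j = 0)
    (W : Matrix (Fin m) (Fin m) ℂ) :
    meanForm f hρ.isHermitian (kronSum Y W) ≤
      meanForm f hρ1.isHermitian Y + meanForm f hρ2.isHermitian W := by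
  have h := hρ.isHermitian
  have h1 := hρ1.isHermitian
  have h2 := hρ2.isHermitian
  have hzero : ∀ (z : MarginalIndex h1 → ℂ) (D : Matrix (Fin m) (Fin m) ℂ),
      (ρ * (firstPart h1 z ⊗ₖ D)).trace = 0 := fun z D =>
    trace_mul_kronecker_eq_zero h1 hcomm (eigenCoord_firstPart_eq_zero h1 z) D
  have hzero' : ∀ (z : MarginalIndex h1 → ℂ) (D : Matrix (Fin m) (Fin m) ℂ),
      (ρ * ((firstPart h1 z)ᴴ ⊗ₖ D)).trace = 0 := fun z D =>
    trace_mul_kronecker_eq_zero h1 hcomm (fun i j hij => by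
      rw [eigenCoord_conjTranspose, conjTranspose_apply,
        eigenCoord_firstPart_eq_zero h1 z j i hij.symm, star_zero]) D
  have hleft := toMatrix_conj_diagonal (marginalMap h h1 h2) (fun a => h.eigenvalues a.1)
    (Sum.elim (fun a => h1.eigenvalues a.1.1) (fun a => h2.eigenvalues a.1)) (fun z w => by
      have e := trace_mul_mul_conjTranspose h (kronSum (firstPart h1 z) (secondPart h1 h2 z))
        (kronSum (firstPart h1 w) (secondPart h1 h2 w))
      refine e.symm.trans ?_
      rw [kronSum_conjTranspose, kronSum_mul, Matrix.mul_add, Matrix.mul_add, Matrix.trace_add,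
        Matrix.trace_add, hzero, hzero', add_zero, add_zero, trace_mul_kronSum,
        trace_mul_mul_conjTranspose h1, trace_mul_mul_conjTranspose h2, Fintype.sum_sum_type,
        sum_subtype_eigenvalues_ne h1 _ (fun a ha => by
          rw [eigenCoord_firstPart_eq_zero h1 w _ _ ha, mul_zero])]
      simp only [eigenCoord_firstPart, eigenCoord_secondPart, Sum.elim_inl, Sum.elim_inr])
  have hright := toMatrix_conj_diagonal (marginalMap h h1 h2) (fun a => h.eigenvalues a.2)
    (Sum.elim (fun a => h1.eigenvalues a.1.2) (fun a => h2.eigenvalues a.2)) (fun z w => by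
      have e := trace_mul_conjTranspose_mul h (kronSum (firstPart h1 z) (secondPart h1 h2 z))
        (kronSum (firstPart h1 w) (secondPart h1 h2 w))
      refine e.symm.trans ?_
      rw [kronSum_conjTranspose, kronSum_mul, Matrix.mul_add, Matrix.mul_add, Matrix.trace_add,
        Matrix.trace_add, hzero, hzero', add_zero, add_zero, trace_mul_kronSum,
        trace_mul_conjTranspose_mul h1, trace_mul_conjTranspose_mul h2, Fintype.sum_sum_type,
        sum_subtype_eigenvalues_ne h1 _ (fun a ha => by
          rw [eigenCoord_firstPart_eq_zero h1 w _ _ ha, mul_zero])]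
      simp only [eigenCoord_firstPart, eigenCoord_secondPart, Sum.elim_inl, Sum.elim_inr])
  let z : MarginalIndex h1 → ℂ :=
    Sum.elim (fun a => eigenCoord h1 Y a.1.1 a.1.2) (fun a => eigenCoord h2 W a.1 a.2)
  have hz1 : firstPart h1 z = Y := by
    apply eigenCoord_injective h1
    ext k l
    by_cases hkl : h1.eigenvalues k = h1.eigenvalues l
    · rw [eigenCoord_firstPart_eq_zero h1 z k l hkl, hY k l hkl]
    · exact eigenCoord_firstPart h1 z ⟨(k, l), hkl⟩
  have hz2 : secondPart h1 h2 z = W := by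
    apply eigenCoord_injective h2
    ext k l
    exact eigenCoord_secondPart h1 h2 z (k, l)
  have hmain := hf.perspective_le hf_symm (LinearMap.toMatrix' (marginalMap h h1 h2))
    (fun a => hρ.eigenvalues_pos a.1) (fun a => hρ.eigenvalues_pos a.2)
    (by
      rintro (b | b)
      · exact hρ1.eigenvalues_pos _
      · exact hρ2.eigenvalues_pos _) hleft hright z
  rw [LinearMap.toMatrix'_mulVec, Fintype.sum_sum_type] at hmain
  simp only [marginalMap, LinearMap.coe_mk, AddHom.coe_mk, hz1, hz2] at hmain
  rw [meanForm, meanForm, meanForm, sum_subtype_eigenvalues_ne h1 _ (fun a ha => by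
    rw [hY _ _ ha, map_zero, mul_zero])]
  exact hmain

end Bipartite

/-- Superadditivity of the metric adjusted skew information for semi-quantum states:
`I^c_ρ(A ⊗ 1₂ + 1₁ ⊗ B) ≥ I^c_{ρ₁}(A) + I^c_{ρ₂}(B)` for a regular `f ∈ F_op`. -/
theorem Ic_superadditive_of_semiQuantum {n m : ℕ} (f : ℝ → ℝ)
    (hf_mono : OperatorMonotone f) (hf_pos : ∀ t > 0, 0 < f t)
    (hf_symm : ∀ t > 0, f t = t * f (1 / t)) (hf_one : f 1 = 1)
    (hf_reg : 0 < f 0)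
    (hf_cont : Filter.Tendsto f (nhdsWithin 0 (Set.Ioi 0)) (nhds (f 0)))
    (ρ : Matrix (Fin n × Fin m) (Fin n × Fin m) ℂ) (hρ : ρ.PosDef) (hρtr : ρ.trace = 1)
    (hsq : IsSemiQuantum ρ)
    (A : Matrix (Fin n) (Fin n) ℂ) (hA : A.IsHermitian)
    (B : Matrix (Fin m) (Fin m) ℂ) (hB : B.IsHermitian) :
    Ic f (ptrace2 ρ) A + Ic f (ptrace1 ρ) B ≤
      Ic f ρ (A ⊗ₖ (1 : Matrix (Fin m) (Fin m) ℂ) +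
        (1 : Matrix (Fin n) (Fin n) ℂ) ⊗ₖ B) := by
  have hne : Nonempty (Fin n × Fin m) := by
    by_contra hemp
    rw [not_nonempty_iff] at hemp
    simp [Matrix.trace] at hρtr
  have hn : Nonempty (Fin n) := hne.map Prod.fst
  have hm : Nonempty (Fin m) := hne.map Prod.snd
  have hρ1 := ptrace2_posDef hρ
  have hρ2 := ptrace1_posDef hρ
  obtain ⟨Y, hY, hYA, hYm⟩ :=
    exists_trace_eq_skewSum hρ1.isHermitian hf_pos hρ1.eigenvalues_pos A
  obtain ⟨W, -, hWB, hWm⟩ :=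
    exists_trace_eq_skewSum hρ2.isHermitian hf_pos hρ2.eigenvalues_pos B
  have hvar := two_mul_trace_sub_meanForm_le hρ.isHermitian hf_pos hρ.eigenvalues_pos
    (kronSum A B) (kronSum Y W)
  rw [trace_commutator_kronSum, Complex.add_re, hYA, hWB] at hvar
  have hle := meanForm_kronSum_le hf_mono hf_symm hρ hρ1 hρ2 hsq.commute Y hY W
  rw [hYm, hWm] at hle
  rw [Ic, Ic, Ic, ← mul_add]
  refine mul_le_mul_of_nonneg_left ?_ (by positivity)
  change _ ≤ skewSum f ρ (kronSum A B)
  linarith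
end

section
/- For 0 < p < 1 let f_p(t) = p(1−p)·(t−1)² / ((t^p − 1)(t^{1−p} − 1)) for t > 0, t ≠ 1, and f_p(1) = 1. Then f_p is a regular function in F_op: f_p(t) > 0 for all t > 0, f_p is operator monotone on (0,∞), f_p(t) = t·f_p(1/t) for all t > 0, f_p(1) = 1, and f_p(t) → p(1−p) > 0 as t → 0⁺. -/
open Matrix Kronecker ComplexOrder

/-- The Wigner-Yanase-Dyson function
`f_p(t) = p(1−p)·(t−1)² / ((tᵖ − 1)(t^{1−p} − 1))` for `t ≠ 1`, and `f_p(1) = 1`. -/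
noncomputable def fWYD (p : ℝ) (t : ℝ) : ℝ :=
  if t = 1 then 1 else p * (1 - p) * (t - 1) ^ 2 / ((t ^ p - 1) * (t ^ (1 - p) - 1))

open MeasureTheory Set Filter Topology in
lemma Real.rpow_tangent_eq_integral {p : ℝ} (hp : p ∈ Ioo (0 : ℝ) 1) :
    ∃ m : ℝ → ℝ, (∀ s > 0, 0 ≤ m s) ∧
      (∀ x > 0, IntegrableOn (fun s => m s * (s + x)⁻¹) (Ioi 0)) ∧
      ∀ x > 0, 1 + p * (x - 1) - x ^ p = (x - 1) ^ 2 * ∫ s in Ioi 0, m s * (s + x)⁻¹ := by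
  set C := ∫ s in Ioi 0, rpowIntegrand₀₁ p s 1 with hC
  have hCpos : 0 < C := integral_rpowIntegrand₀₁_one_pos hp
  have hk (x : ℝ) (hx : 0 ≤ x) := integrableOn_rpowIntegrand₀₁_Ioi hp hx
  set m : ℝ → ℝ := fun s => C⁻¹ * (rpowIntegrand₀₁ p s 1 * (s * (s + 1)⁻¹)) with hm
  have hm0 : ∀ s > 0, 0 ≤ m s := fun s hs => by
    have := rpowIntegrand₀₁_nonneg hp.1 hs.le zero_le_one
    positivity
  have hmi : IntegrableOn m (Ioi 0) := by
    refine Integrable.const_mul (Integrable.mul_bdd (c := 1) (hk 1 zero_le_one) (by fun_prop) ?_) _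
    refine ae_restrict_of_forall_mem measurableSet_Ioi fun s (hs : 0 < s) => ?_
    rw [norm_of_nonneg (by positivity), ← div_eq_mul_inv, div_le_one (by positivity)]
    linarith
  have hmr : ∀ x > 0, IntegrableOn (fun s => m s * (s + x)⁻¹) (Ioi 0) := fun x hx => by
    refine Integrable.mul_bdd (c := x⁻¹) hmi (by fun_prop) ?_
    refine ae_restrict_of_forall_mem measurableSet_Ioi fun s (hs : 0 < s) => ?_
    rw [norm_of_nonneg (by positivity)]
    gcongr
    linarith
  have key : ∀ x > 0, 1 + (∫ s in Ioi 0, m s) * (x - 1) - x ^ p =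
      (x - 1) ^ 2 * ∫ s in Ioi 0, m s * (s + x)⁻¹ := fun x hx => by
    have h1 : x ^ p = C⁻¹ * ∫ s in Ioi 0, rpowIntegrand₀₁ p s x := by
      rw [integral_rpowIntegrand₀₁_eq_rpow_mul_const hp hx.le, ← hC]
      field_simp
    have h2 : (1 : ℝ) = C⁻¹ * ∫ s in Ioi 0, rpowIntegrand₀₁ p s 1 := by
      rw [← hC, inv_mul_cancel₀ hCpos.ne']
    have e : ∀ s ∈ Ioi (0 : ℝ), (x - 1) ^ 2 * (m s * (s + x)⁻¹) =
        C⁻¹ * rpowIntegrand₀₁ p s 1 + (x - 1) * m s - C⁻¹ * rpowIntegrand₀₁ p s x := by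
      intro s (hs : 0 < s)
      simp only [hm, rpowIntegrand₀₁_eq_pow_div hp hs.le hx.le,
        rpowIntegrand₀₁_eq_pow_div hp hs.le zero_le_one]
      field_simp
      ring
    rw [← integral_const_mul ((x - 1) ^ 2), setIntegral_congr_fun measurableSet_Ioi e,
      integral_sub, integral_add, integral_const_mul C⁻¹ (rpowIntegrand₀₁ p · 1),
      integral_const_mul (x - 1) m, integral_const_mul C⁻¹ (rpowIntegrand₀₁ p · x), ← h1, ← h2]
    · ring
    · exact (hk 1 zero_le_one).const_mul _
    · exact hmi.const_mul _
    · exact ((hk 1 zero_le_one).const_mul _).add (hmi.const_mul _)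
    · exact (hk x hx.le).const_mul _
  have hD : ∫ s in Ioi 0, m s = p := by
    set D := ∫ s in Ioi 0, m s
    have hmin : IsLocalMin (fun x : ℝ => 1 + D * (x - 1) - x ^ p) 1 := by
      filter_upwards [lt_mem_nhds (zero_lt_one' ℝ)] with x hx
      rw [key x hx]
      simp only [sub_self, mul_zero, add_zero, one_rpow]
      exact mul_nonneg (sq_nonneg _) (setIntegral_nonneg measurableSet_Ioi fun s (hs : 0 < s) =>
        mul_nonneg (hm0 s hs) (by positivity))
    have hd : HasDerivAt (fun x : ℝ => 1 + D * (x - 1) - x ^ p) (D - p) 1 := by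
      have h1 := (((hasDerivAt_id (1 : ℝ)).sub_const 1).const_mul D).const_add 1
      have h2 := Real.hasDerivAt_rpow_const (x := 1) (p := p) (Or.inl one_ne_zero)
      simpa [Pi.sub_def] using h1.sub h2
    linarith [hmin.hasDerivAt_eq_zero hd]
  exact ⟨m, hm0, hmr, hD ▸ key⟩

lemma matFun_eq_cfc {ι : Type} [Fintype ι] [DecidableEq ι] {M : Matrix ι ι ℂ} (hM : M.IsHermitian)
    (g : ℝ → ℝ) : matFun g M = cfc g M := by
  rw [hM.cfc_eq, matFun, dif_pos hM, Matrix.IsHermitian.cfc, Unitary.conjStarAlgAut_apply]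
  ext i j
  simp [Matrix.sum_apply, Matrix.mul_apply, Matrix.vecMulVec_apply, Matrix.diagonal_apply,
    Matrix.star_apply, mul_comm, mul_assoc]

lemma Matrix.IsHermitian.exists_quadForm_cfc_eq_sum {ι : Type} [Fintype ι] [DecidableEq ι]
    {M : Matrix ι ι ℂ} (hM : M.IsHermitian) (x : ι → ℂ) :
    ∃ c : ι → ℝ, ∀ g : ℝ → ℝ,
      star x ⬝ᵥ (cfc g M *ᵥ x) = ((∑ i, g (hM.eigenvalues i) * c i : ℝ) : ℂ) := by
  refine ⟨fun i => Complex.normSq (star (⇑(hM.eigenvectorBasis i)) ⬝ᵥ x), fun g => ?_⟩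
  rw [← matFun_eq_cfc hM, matFun, dif_pos hM, Matrix.sum_mulVec, dotProduct_sum]
  push_cast
  refine Finset.sum_congr rfl fun i _ => ?_
  rw [Matrix.smul_mulVec, dotProduct_smul, Matrix.vecMulVec_mulVec, dotProduct_smul,
    Complex.normSq_eq_conj_mul_self, starRingEnd_apply, ← Matrix.star_dotProduct, smul_eq_mul,
    MulOpposite.smul_eq_mul_unop, MulOpposite.unop_op]

lemma Matrix.PosDef.pos_of_mem_spectrum {ι : Type} [Fintype ι] [DecidableEq ι] {A : Matrix ι ι ℂ}
    (hA : A.PosDef) {t : ℝ} (ht : t ∈ spectrum ℝ A) : 0 < t := by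
  rw [hA.isHermitian.spectrum_real_eq_range_eigenvalues] at ht
  obtain ⟨i, rfl⟩ := ht
  exact hA.eigenvalues_pos i

open scoped MatrixOrder Matrix.Norms.L2Operator in
lemma Matrix.PosDef.cfc_inv_le_cfc_inv {ι : Type} [Fintype ι] [DecidableEq ι]
    {A B : Matrix ι ι ℂ} (hA : A.PosDef) (hB : B.PosDef) {g : ℝ → ℝ} (hg : ∀ t > 0, 0 < g t)
    (h : cfc g A ≤ cfc g B) : cfc (fun t => (g t)⁻¹) B ≤ cfc (fun t => (g t)⁻¹) A := by
  have hc (M : Matrix ι ι ℂ) : ContinuousOn g (spectrum ℝ M) :=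
    Matrix.finite_real_spectrum.continuousOn _
  have hpos {M : Matrix ι ι ℂ} (hM : M.PosDef) : ∀ t ∈ spectrum ℝ M, 0 < g t := fun t ht =>
    hg t (hM.pos_of_mem_spectrum ht)
  have hsp {M : Matrix ι ι ℂ} (hM : M.PosDef) : IsStrictlyPositive (cfc g M) :=
    (cfc_isStrictlyPositive_iff g M (hc M) hM.isHermitian.isSelfAdjoint).2 (hpos hM)
  rw [cfc_inv g A (fun t ht => (hpos hA t ht).ne') (hc A) hA.isHermitian.isSelfAdjoint,
    cfc_inv g B (fun t ht => (hpos hB t ht).ne') (hc B) hB.isHermitian.isSelfAdjoint]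
  exact CStarAlgebra.antitoneOn_ringInverse (hsp hA) (hsp hB) h

open scoped MatrixOrder Matrix.Norms.L2Operator in
lemma Matrix.PosDef.cfc_resolvent_le_cfc_resolvent {ι : Type} [Fintype ι] [DecidableEq ι]
    {A B : Matrix ι ι ℂ} (hA : A.PosDef) (hB : B.PosDef) (hAB : A ≤ B) {s : ℝ} (hs : 0 < s) :
    cfc (fun t => (s + t)⁻¹) B ≤ cfc (fun t => (s + t)⁻¹) A := by
  refine hA.cfc_inv_le_cfc_inv hB (g := fun t => s + t) (fun t ht => by positivity) ?_
  rw [cfc_const_add s _ A (by fun_prop) hA.isHermitian.isSelfAdjoint,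
    cfc_const_add s _ B (by fun_prop) hB.isHermitian.isSelfAdjoint,
    cfc_id' ℝ A hA.isHermitian.isSelfAdjoint, cfc_id' ℝ B hB.isHermitian.isSelfAdjoint]
  gcongr

open MeasureTheory Set in
open scoped MatrixOrder in
lemma Matrix.PosDef.cfc_integral_resolvent_le {ι : Type} [Fintype ι] [DecidableEq ι]
    {A B : Matrix ι ι ℂ} (hA : A.PosDef) (hB : B.PosDef) (hAB : A ≤ B) {m : ℝ → ℝ}
    (hm : ∀ s > 0, 0 ≤ m s)
    (hmi : ∀ x > 0, IntegrableOn (fun s => m s * (s + x)⁻¹) (Ioi 0)) :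
    cfc (fun t => ∫ s in Ioi 0, m s * (s + t)⁻¹) B ≤
      cfc (fun t => ∫ s in Ioi 0, m s * (s + t)⁻¹) A := by
  rw [Matrix.le_iff]
  refine Matrix.PosSemidef.of_dotProduct_mulVec_nonneg
    (Matrix.IsHermitian.sub (cfc_predicate (R := ℝ) _ A) (cfc_predicate (R := ℝ) _ B)) fun x => ?_
  obtain ⟨a, ha⟩ := hA.isHermitian.exists_quadForm_cfc_eq_sum x
  obtain ⟨b, hb⟩ := hB.isHermitian.exists_quadForm_cfc_eq_sum x
  have hint {M : Matrix ι ι ℂ} (hM : M.PosDef) (c : ι → ℝ) (i : ι) :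
      IntegrableOn (fun s => m s * (s + hM.isHermitian.eigenvalues i)⁻¹ * c i) (Ioi 0) :=
    (hmi _ (hM.eigenvalues_pos i)).mul_const _
  rw [Matrix.sub_mulVec, dotProduct_sub, ha, hb, ← Complex.ofReal_sub, Complex.zero_le_real]
  simp_rw [← integral_mul_const]
  rw [← integral_finsetSum _ fun i _ => hint hA a i, ← integral_finsetSum _ fun i _ => hint hB b i,
    ← integral_sub (integrable_finsetSum _ fun i _ => hint hA a i)
      (integrable_finsetSum _ fun i _ => hint hB b i)]
  refine setIntegral_nonneg measurableSet_Ioi fun s (hs : 0 < s) => ?_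
  have h := (Matrix.le_iff.1 (hA.cfc_resolvent_le_cfc_resolvent hB hAB hs)).dotProduct_mulVec_nonneg x
  rw [Matrix.sub_mulVec, dotProduct_sub, ha, hb, ← Complex.ofReal_sub, Complex.zero_le_real] at h
  simp_rw [mul_assoc, ← Finset.mul_sum, ← mul_sub]
  exact mul_nonneg (hm s hs) h

lemma fWYD_of_ne_one (p : ℝ) {t : ℝ} (ht : t ≠ 1) :
    fWYD p t = p * (1 - p) * (t - 1) ^ 2 / ((t ^ p - 1) * (t ^ (1 - p) - 1)) := if_neg ht

lemma Real.rpow_sub_one_mul_rpow_sub_one_pos {p q t : ℝ} (hp : 0 < p) (hq : 0 < q) (ht : 0 < t)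
    (ht1 : t ≠ 1) : 0 < (t ^ p - 1) * (t ^ q - 1) := by
  rcases ht1.lt_or_gt with h | h
  · exact mul_pos_of_neg_of_neg (sub_neg.2 (rpow_lt_one ht.le h hp))
      (sub_neg.2 (rpow_lt_one ht.le h hq))
  · exact mul_pos (sub_pos.2 (one_lt_rpow h hp)) (sub_pos.2 (one_lt_rpow h hq))

lemma fWYD_pos {p : ℝ} (hp0 : 0 < p) (hp1 : p < 1) {t : ℝ} (ht : 0 < t) : 0 < fWYD p t := by
  by_cases h1 : t = 1
  · simp [fWYD, h1]
  · rw [fWYD_of_ne_one p h1]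
    have := Real.rpow_sub_one_mul_rpow_sub_one_pos hp0 (sub_pos.2 hp1) ht h1
    have := sub_pos.2 hp1
    have := sq_pos_of_ne_zero (sub_ne_zero.2 h1)
    positivity

lemma fWYD_symm {p : ℝ} (hp0 : 0 < p) (hp1 : p < 1) {t : ℝ} (ht : 0 < t) :
    fWYD p t = t * fWYD p (1 / t) := by
  by_cases h1 : t = 1
  · simp [fWYD, h1]
  · have h1' : 1 / t ≠ 1 := by simpa using h1
    rw [fWYD_of_ne_one p h1, fWYD_of_ne_one p h1', one_div, Real.inv_rpow ht.le,
      Real.inv_rpow ht.le]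
    have hne := (Real.rpow_sub_one_mul_rpow_sub_one_pos hp0 (sub_pos.2 hp1) ht h1).ne'
    have ha := Real.rpow_pos_of_pos ht p
    have hb := Real.rpow_pos_of_pos ht (1 - p)
    have hab : t ^ p * t ^ (1 - p) = t := by
      rw [← Real.rpow_add ht, add_sub_cancel, Real.rpow_one]
    generalize t ^ p = a at *
    generalize t ^ (1 - p) = b at *
    have e : (a⁻¹ - 1) * (b⁻¹ - 1) = (a - 1) * (b - 1) / t := by
      rw [← hab]
      field_simp
      ring
    rw [e]
    field_simp
    ring

open Filter Topology in
lemma tendsto_fWYD_zero {p : ℝ} (hp0 : 0 < p) (hp1 : p < 1) :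
    Tendsto (fWYD p) (𝓝[>] 0) (𝓝 (p * (1 - p))) := by
  have hr {q : ℝ} (hq : 0 < q) : Tendsto (fun t : ℝ => t ^ q - 1) (𝓝 0) (𝓝 (-1)) := by
    have := (Real.continuousAt_rpow_const 0 q (Or.inr hq.le)).tendsto.sub_const 1
    simpa [Real.zero_rpow hq.ne'] using this
  have hn : Tendsto (fun t : ℝ => p * (1 - p) * (t - 1) ^ 2) (𝓝 0) (𝓝 (p * (1 - p))) :=
    Continuous.tendsto' (by fun_prop) _ _ (by simp)
  have h := hn.div ((hr hp0).mul (hr (sub_pos.2 hp1))) (by norm_num)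
  rw [neg_one_mul, neg_neg, div_one] at h
  refine (h.congr' ?_).mono_left nhdsWithin_le_nhds
  filter_upwards [gt_mem_nhds (zero_lt_one' ℝ)] with t ht
  exact (fWYD_of_ne_one p ht.ne).symm

open Filter Topology in
lemma tendsto_fWYD_one {p : ℝ} (hp0 : 0 < p) (hp1 : p < 1) :
    Tendsto (fWYD p) (𝓝[≠] 1) (𝓝 1) := by
  have hs (q : ℝ) : Tendsto (fun t : ℝ => (t ^ q - 1) / (t - 1)) (𝓝[≠] 1) (𝓝 q) := by
    have h := hasDerivAt_iff_tendsto_slope.1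
      (Real.hasDerivAt_rpow_const (x := 1) (p := q) (Or.inl one_ne_zero))
    simpa [slope_fun_def_field] using h
  have hq := sub_pos.2 hp1
  have h := (tendsto_const_nhds (x := p * (1 - p))).div ((hs p).mul (hs (1 - p))) (by positivity)
  rw [div_self (by positivity)] at h
  refine h.congr' ?_
  filter_upwards [self_mem_nhdsWithin] with t (ht : t ≠ 1)
  rw [fWYD_of_ne_one p ht, Pi.div_apply, div_mul_div_comm, div_div_eq_mul_div, sq]

open MeasureTheory Set Filter Topology in
lemma exists_fWYD_eq_div_integral_resolvent {p : ℝ} (hp0 : 0 < p) (hp1 : p < 1) :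
    ∃ m : ℝ → ℝ, (∀ s > 0, 0 ≤ m s) ∧
      (∀ x > 0, IntegrableOn (fun s => m s * (s + x)⁻¹) (Ioi 0)) ∧
      ∀ x > 0, fWYD p x = p * (1 - p) * (∫ s in Ioi 0, m s * (s + x)⁻¹)⁻¹ := by
  obtain ⟨m₁, hm₁, hi₁, h₁⟩ := Real.rpow_tangent_eq_integral ⟨hp0, hp1⟩
  obtain ⟨m₂, hm₂, hi₂, h₂⟩ :=
    Real.rpow_tangent_eq_integral (p := 1 - p) ⟨sub_pos.2 hp1, sub_lt_self 1 hp0⟩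
  set m : ℝ → ℝ := fun s => m₁ s + m₂ s with hmdef
  have hm : ∀ s > 0, 0 ≤ m s := fun s hs => add_nonneg (hm₁ s hs) (hm₂ s hs)
  have hi : ∀ x > 0, IntegrableOn (fun s => m s * (s + x)⁻¹) (Ioi 0) := fun x hx => by
    simpa only [hmdef, add_mul, Pi.add_def] using (hi₁ x hx).add (hi₂ x hx)
  refine ⟨m, hm, hi, ?_⟩
  set H : ℝ → ℝ := fun x => ∫ s in Ioi 0, m s * (s + x)⁻¹ with hH
  have hpq : 0 < p * (1 - p) := mul_pos hp0 (sub_pos.2 hp1)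
  have key : ∀ x > 0, x ≠ 1 → fWYD p x * H x = p * (1 - p) := fun x hx hx1 => by
    have hab : x ^ p * x ^ (1 - p) = x := by
      rw [← Real.rpow_add hx, add_sub_cancel, Real.rpow_one]
    have hsum : H x = (∫ s in Ioi 0, m₁ s * (s + x)⁻¹) + ∫ s in Ioi 0, m₂ s * (s + x)⁻¹ := by
      rw [← integral_add (hi₁ x hx) (hi₂ x hx)]
      simp only [hH, hmdef, add_mul]
    have e : (x ^ p - 1) * (x ^ (1 - p) - 1) = (x - 1) ^ 2 * H x := by
      rw [hsum, mul_add, ← h₁ x hx, ← h₂ x hx]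
      linear_combination hab
    have hne := (Real.rpow_sub_one_mul_rpow_sub_one_pos hp0 (sub_pos.2 hp1) hx hx1).ne'
    rw [fWYD_of_ne_one p hx1, div_mul_eq_mul_div, div_eq_iff hne, e]
    ring
  have hle : ∀ x > 1, H x ≤ H 1 := fun x hx => by
    refine setIntegral_mono_on (hi x (by linarith)) (hi 1 one_pos) measurableSet_Ioi
      fun s (hs : 0 < s) => ?_
    have := hm s hs
    gcongr
  have hge : ∀ x > 1, x⁻¹ * H 1 ≤ H x := fun x hx => by
    rw [hH, ← integral_const_mul]
    refine setIntegral_mono_on ((hi 1 one_pos).const_mul _) (hi x (by linarith)) measurableSet_Ioi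
      fun s (hs : 0 < s) => ?_
    have := hm s hs
    rw [mul_left_comm, ← mul_inv]
    gcongr
    nlinarith
  have hH1 : Tendsto H (𝓝[>] 1) (𝓝 (H 1)) := by
    have hl : Tendsto (fun x : ℝ => x⁻¹ * H 1) (𝓝[>] 1) (𝓝 (H 1)) := by
      have := ((tendsto_inv₀ (one_ne_zero (α := ℝ))).mul_const (H 1)).mono_left
        (nhdsWithin_le_nhds (s := Ioi 1))
      simpa using this
    exact tendsto_of_tendsto_of_tendsto_of_le_of_le' hl tendsto_const_nhds
      (eventually_nhdsWithin_of_forall hge) (eventually_nhdsWithin_of_forall hle)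
  have h1 : H 1 = p * (1 - p) := by
    have hl := ((tendsto_fWYD_one hp0 hp1).mono_left
      (nhdsWithin_mono (s := Ioi 1) 1 fun x (hx : 1 < x) => hx.ne')).mul hH1
    rw [one_mul] at hl
    refine tendsto_nhds_unique (l := 𝓝[>] (1 : ℝ)) hl (tendsto_const_nhds.congr' ?_)
    filter_upwards [self_mem_nhdsWithin] with x (hx : 1 < x)
    exact (key x (by linarith) hx.ne').symm
  intro x hx
  change fWYD p x = p * (1 - p) * (H x)⁻¹
  by_cases hx1 : x = 1
  · rw [hx1, h1, mul_inv_cancel₀ hpq.ne', fWYD, if_pos rfl]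
  · have hk := key x hx hx1
    have : H x ≠ 0 := fun h0 => hpq.ne (by rw [← hk, h0, mul_zero])
    rw [← hk, mul_inv_cancel_right₀ this]

open MeasureTheory Set in
open scoped MatrixOrder in
lemma operatorMonotone_fWYD {p : ℝ} (hp0 : 0 < p) (hp1 : p < 1) : OperatorMonotone (fWYD p) := by
  obtain ⟨m, hm, hmi, hf⟩ := exists_fWYD_eq_div_integral_resolvent hp0 hp1
  have hpq : 0 < p * (1 - p) := mul_pos hp0 (sub_pos.2 hp1)
  intro k A B hA hB hAB
  rw [matFun_eq_cfc hA.isHermitian, matFun_eq_cfc hB.isHermitian, ← Matrix.le_iff]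
  have hH : ∀ x > 0, 0 < ∫ s in Ioi 0, m s * (s + x)⁻¹ := fun x hx => by
    have := fWYD_pos hp0 hp1 hx
    rw [hf x hx] at this
    exact inv_pos.1 (pos_of_mul_pos_right this hpq.le)
  have hc {M : Matrix (Fin k) (Fin k) ℂ} (hM : M.PosDef) :
      cfc (fWYD p) M = (p * (1 - p)) • cfc (fun x => (∫ s in Ioi 0, m s * (s + x)⁻¹)⁻¹) M := by
    rw [← cfc_smul _ _ M (Matrix.finite_real_spectrum.continuousOn _)]
    exact cfc_congr fun x hx => hf x (hM.pos_of_mem_spectrum hx)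
  rw [hc hA, hc hB]
  have h := hB.cfc_inv_le_cfc_inv hA hH (hA.cfc_integral_resolvent_le hB hAB hm hmi)
  rw [Matrix.le_iff] at h ⊢
  rw [← smul_sub]
  exact h.smul hpq.le

/-- For `0 < p < 1` the function `f_p` is a regular function in `F_op`: it is positive
on `(0,∞)`, operator monotone, satisfies `f_p(t) = t·f_p(1/t)` and `f_p(1) = 1`, and
`f_p(t) → p(1−p) > 0` as `t → 0⁺`. -/
theorem fWYD_regular_Fop (p : ℝ) (hp0 : 0 < p) (hp1 : p < 1) :
    (∀ t > 0, 0 < fWYD p t) ∧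
    OperatorMonotone (fWYD p) ∧
    (∀ t > 0, fWYD p t = t * fWYD p (1 / t)) ∧
    fWYD p 1 = 1 ∧
    Filter.Tendsto (fWYD p) (nhdsWithin 0 (Set.Ioi 0)) (nhds (p * (1 - p))) ∧
    0 < p * (1 - p) := by
  exact ⟨fun _ => fWYD_pos hp0 hp1, operatorMonotone_fWYD hp0 hp1, fun _ => fWYD_symm hp0 hp1,
    if_pos rfl, tendsto_fWYD_zero hp0 hp1, mul_pos hp0 (sub_pos.2 hp1)⟩
end
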